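/- Let ξ be a stationary point process on ℝ^d with intensity γ ∈ (0, ∞), and let ξ^o be a Palm version of ξ at the origin, i.e. a point process satisfying E[∫ f(z, θ_{−z} ξ) ξ(dz)] = γ ∫_{ℝ^d} E[f(z, ξ^{o})] dz for all measurable f : ℝ^d × N → [0,∞]. Let A ⊂ ℝ^d be a Borel set such that (z, μ) ↦ μ_{A_z} is product measurable, and let B ⊂ ℝ^d be compact with |B| > 0. Then for all p, q > 0 with 1/p + 1/q ≤ 1: sup_{𝐀 measurable ⊆ N} |P(ξ_A ∈ 𝐀) − P((ξ^{o})_A ∈ 𝐀)| ≤ 4 · (E[ξ(B)^p])^{1/p} / E[ξ(B)] · (β^ξ_{B, B+A})^{1 − 1/p − 1/q}. -/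

import Mathlib

open MeasureTheory ENNReal Pointwise

lemma isCompact_setOf_forall_le (m : ℕ → ℕ) : IsCompact {x : ℕ → ℕ | ∀ i, x i ≤ m i} := by
  have h := isCompact_univ_pi (fun i => (Set.finite_Iic (m i)).isCompact)
  rwa [Set.pi_univ_Iic] at h

lemma exists_forall_le_subset_of_isOpen {V : Set (ℕ → ℕ)} (hV : IsOpen V) (m : ℕ → ℕ)
    (hm : {x | ∀ i, x i ≤ m i} ⊆ V) : ∃ k, {x : ℕ → ℕ | ∀ i < k, x i ≤ m i} ⊆ V := by
  let := PiNat.metricSpaceNatNat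
  obtain ⟨δ, hδ, hsub⟩ := (isCompact_setOf_forall_le m).exists_thickening_subset_open hV hm
  obtain ⟨k, hk⟩ := exists_pow_lt_of_lt_one hδ (by norm_num : (1 / 2 : ℝ) < 1)
  refine ⟨k, fun x hx => hsub ?_⟩
  rw [Metric.mem_thickening_iff]
  refine ⟨fun i => min (x i) (m i), fun i => min_le_right _ _, lt_of_le_of_lt ?_ hk⟩
  rw [← PiNat.mem_cylinder_iff_dist_le]
  intro i hi
  exact (min_eq_left (hx i hi)).symm

lemma MeasureTheory.AnalyticSet.exists_isCompact_le_measure {α : Type*} [TopologicalSpace α]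
    [MeasurableSpace α] [BorelSpace α] {μ : Measure α} [μ.OuterRegular] {s : Set α}
    (hs : AnalyticSet s) {c : ℝ≥0∞} (hc : c < μ s) :
    ∃ K ⊆ s, IsCompact K ∧ c ≤ μ K := by
  rw [AnalyticSet] at hs
  obtain rfl | ⟨f, hf, rfl⟩ := hs
  · simp at hc
  have step (k : ℕ) (C : {C : Set (ℕ → ℕ) // c < μ (f '' C)}) :
      ∃ n, c < μ (f '' (C.1 ∩ {x | x k ≤ n})) := by
    have hmono : Monotone fun n : ℕ => f '' (C.1 ∩ {x | x k ≤ n}) := fun a b hab =>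
      Set.image_mono (Set.inter_subset_inter_right _ fun x (hx : x k ≤ a) => hx.trans hab)
    have hU : ⋃ n : ℕ, f '' (C.1 ∩ {x | x k ≤ n}) = f '' C.1 := by
      rw [← Set.image_iUnion, ← Set.inter_iUnion]
      congr 1
      exact Set.inter_eq_left.2 fun x _ => Set.mem_iUnion.2 ⟨x k, le_refl (x k)⟩
    have := C.2
    rw [← hU, hmono.measure_iUnion] at this
    exact lt_iSup_iff.1 this
  choose N hN using step
  let C : ℕ → {C : Set (ℕ → ℕ) // c < μ (f '' C)} := fun k =>
    Nat.rec ⟨Set.univ, by simpa using hc⟩ (fun k C => ⟨_, hN k C⟩) k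
  let m : ℕ → ℕ := fun k => N k (C k)
  have hC : ∀ k, (C k).1 = {x | ∀ i < k, x i ≤ m i} := by
    intro k
    induction k with
    | zero => simp [C]
    | succ k ih =>
      change (C k).1 ∩ {x | x k ≤ m k} = _
      rw [ih]
      ext x
      exact Nat.forall_lt_succ_right.symm
  refine ⟨f '' {x | ∀ i, x i ≤ m i}, Set.image_subset_range _ _, (isCompact_setOf_forall_le m).image hf, ?_⟩
  rw [Set.measure_eq_iInf_isOpen]
  refine le_iInf₂ fun U hU => le_iInf fun hUo => ?_
  obtain ⟨k, hk⟩ := exists_forall_le_subset_of_isOpen (hUo.preimage hf) m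
    (Set.image_subset_iff.1 hU)
  rw [← hC k] at hk
  exact (C k).2.le.trans (measure_mono (Set.image_subset_iff.2 hk))

lemma MeasureTheory.AnalyticSet.nullMeasurableSet_of_isFiniteMeasure {α : Type*}
    [TopologicalSpace α] [T2Space α] [MeasurableSpace α] [BorelSpace α] {μ : Measure α}
    [IsFiniteMeasure μ] [μ.OuterRegular] {s : Set α} (hs : AnalyticSet s) :
    NullMeasurableSet s μ := by
  rcases eq_or_ne (μ s) 0 with h0 | h0
  · exact .of_null h0
  obtain ⟨u, -, hu, hlim⟩ := exists_seq_strictMono_tendsto' (pos_iff_ne_zero.2 h0)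
  choose K hKs hK hle using fun n => hs.exists_isCompact_le_measure (hu n).2
  have hsub : ⋃ n, K n ⊆ s := Set.iUnion_subset hKs
  have hmeas : MeasurableSet (⋃ n, K n) := .iUnion fun n => (hK n).measurableSet
  have hμ : μ s ≤ μ (⋃ n, K n) :=
    le_of_tendsto' hlim fun n => (hle n).trans (measure_mono (Set.subset_iUnion _ n))
  refine ⟨_, hmeas, (ae_eq_of_subset_of_measure_ge hsub hμ hmeas.nullMeasurableSet
    (measure_ne_top _ _)).symm⟩

lemma MeasureTheory.AnalyticSet.nullMeasurableSet {α : Type*}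
    [TopologicalSpace α] [PolishSpace α] [MeasurableSpace α] [BorelSpace α] {μ : Measure α}
    [SFinite μ] {s : Set α} (hs : AnalyticSet s) :
    NullMeasurableSet s μ := by
  let := TopologicalSpace.upgradeIsCompletelyMetrizable α
  exact (hs.nullMeasurableSet_of_isFiniteMeasure (μ := μ.toFinite)).mono_ac
    (absolutelyContinuous_toFinite μ)

lemma lintegral_le_lintegral_add_of_tv_le {α : Type*} [MeasurableSpace α] {J Q : Measure α}
    [IsFiniteMeasure J] [IsFiniteMeasure Q] {β : ℝ≥0∞}
    (hβ : ∀ C, MeasurableSet C → J C - Q C ≤ β) {H h : α → ℝ≥0∞}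
    (hh : Measurable h) (hHh : ∀ x, H x ≤ h x) {p : ℝ} (hp : 1 < p) :
    ∫⁻ x, H x ∂J ≤ ∫⁻ x, H x ∂Q + (∫⁻ x, h x ^ p ∂J) ^ (1 / p) * β ^ (1 - 1 / p) := by
  obtain ⟨s, hs⟩ := exists_isHahnDecomposition Q J
  have hsm := hs.measurableSet
  set ν := J.restrict s - Q.restrict s with hν
  have hJ : J ≤ Q + ν := by
    calc J = J.restrict s + J.restrict sᶜ := (Measure.restrict_add_restrict_compl hsm).symm
      _ = ν + Q.restrict s + J.restrict sᶜ := by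
        rw [hν, Measure.sub_add_cancel_of_le hs.le_on]
      _ ≤ ν + Q.restrict s + Q.restrict sᶜ := add_le_add le_rfl hs.ge_on_compl
      _ = Q + ν := by rw [add_assoc, Measure.restrict_add_restrict_compl hsm, add_comm]
  have hνJ : ν ≤ J := Measure.sub_le.trans Measure.restrict_le_self
  have hνβ : ν Set.univ ≤ β := by
    rw [hν, Measure.sub_apply MeasurableSet.univ hs.le_on]
    simpa using hβ s hsm
  have hpq := Real.HolderConjugate.conjExponent hp
  have hexp : 1 / p.conjExponent = 1 - 1 / p := by
    have := hpq.inv_add_inv_eq_one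
    simp only [one_div]; linarith
  have holder := ENNReal.lintegral_mul_le_Lp_mul_Lq ν hpq hh.aemeasurable
    (aemeasurable_const (b := (1 : ℝ≥0∞)))
  have hpos : 0 ≤ 1 - 1 / p := by rw [← hexp]; exact one_div_nonneg.2 hpq.symm.nonneg
  calc ∫⁻ x, H x ∂J ≤ ∫⁻ x, H x ∂(Q + ν) := lintegral_mono' hJ le_rfl
    _ = ∫⁻ x, H x ∂Q + ∫⁻ x, H x ∂ν := lintegral_add_measure ..
    _ ≤ ∫⁻ x, H x ∂Q + ∫⁻ x, h x ∂ν := by gcongr; exact hHh _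
    _ ≤ ∫⁻ x, H x ∂Q + (∫⁻ x, h x ^ p ∂ν) ^ (1 / p) * (ν Set.univ) ^ (1 - 1 / p) := by
      gcongr
      simpa [hexp] using holder
    _ ≤ _ := by gcongr

section Kernels

open ProbabilityTheory

/-- The kernel normalizing finite measures to total mass one. -/
noncomputable def normalizeKernel (α : Type*) [MeasurableSpace α] : Kernel (Measure α) α where
  toFun μ := (μ Set.univ)⁻¹ • μ
  measurable' := by
    refine Measure.measurable_of_measurable_coe _ fun s hs => ?_
    simp only [Measure.smul_apply, smul_eq_mul]
    exact (Measure.measurable_coe .univ).inv.mul (Measure.measurable_coe hs)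

instance (α : Type*) [MeasurableSpace α] : IsFiniteKernel (normalizeKernel α) where
  exists_univ_le := ⟨1, by simp, fun μ => by
    exact ENNReal.inv_mul_le_one (μ Set.univ)⟩

/-- An s-finite kernel sending every finite measure to itself. -/
noncomputable def finitePartKernel (α : Type*) [MeasurableSpace α] : Kernel (Measure α) α :=
  (normalizeKernel α).withDensity fun μ _ => ((μ Set.univ).toNNReal : ℝ≥0∞)

instance (α : Type*) [MeasurableSpace α] : IsSFiniteKernel (finitePartKernel α) := by
  unfold finitePartKernel; infer_instance

lemma finitePartKernel_apply {α : Type*} [MeasurableSpace α] (μ : Measure α) [IsFiniteMeasure μ] :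
    finitePartKernel α μ = μ := by
  have hm : Measurable (Function.uncurry fun (μ : Measure α) (_ : α) =>
      ((μ Set.univ).toNNReal : ℝ≥0∞)) := by
    have : Measurable fun x : Measure α × α => x.1 Set.univ :=
      (Measure.measurable_coe .univ).comp measurable_fst
    exact this.ennreal_toNNReal.coe_nnreal_ennreal
  rw [finitePartKernel, Kernel.withDensity_apply _ hm, withDensity_const]
  change _ • ((μ Set.univ)⁻¹ • μ) = μ
  rcases eq_or_ne μ 0 with rfl | h
  · simp
  rw [ENNReal.coe_toNNReal (measure_ne_top _ _), smul_smul, ENNReal.mul_inv_cancel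
    (by simpa using h) (measure_ne_top _ _), one_smul]

lemma measurable_measure_restrict {α : Type*} [MeasurableSpace α] {A : Set α}
    (hA : MeasurableSet A) : Measurable fun μ : Measure α => μ.restrict A := by
  refine Measure.measurable_of_measurable_coe _ fun s hs => ?_
  simp only [Measure.restrict_apply hs]
  exact Measure.measurable_coe (hs.inter hA)

/-- An s-finite kernel sending every measure that is finite on each `K n` to the sum of its
restrictions to the `K n`. -/
noncomputable def piecewiseFiniteKernel {α : Type*} [MeasurableSpace α] {K : ℕ → Set α}
    (hK : ∀ n, MeasurableSet (K n)) : Kernel (Measure α) α :=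
  Kernel.sum fun n => (finitePartKernel α).comap (fun μ => μ.restrict (K n))
    (measurable_measure_restrict (hK n))

instance {α : Type*} [MeasurableSpace α] {K : ℕ → Set α}
    (hK : ∀ n, MeasurableSet (K n)) : IsSFiniteKernel (piecewiseFiniteKernel hK) := by
  unfold piecewiseFiniteKernel; infer_instance

lemma piecewiseFiniteKernel_apply {α : Type*} [MeasurableSpace α] {K : ℕ → Set α}
    (hK : ∀ n, MeasurableSet (K n)) (hd : Pairwise (Function.onFun Disjoint K))
    (hU : ⋃ n, K n = Set.univ) {μ : Measure α} (hμ : ∀ n, μ (K n) < ∞) :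
    piecewiseFiniteKernel hK μ = μ := by
  rw [piecewiseFiniteKernel, Kernel.sum_apply]
  conv_rhs => rw [← μ.restrict_univ, ← hU, Measure.restrict_iUnion hd hK]
  congr 1
  ext1 n
  have : IsFiniteMeasure (μ.restrict (K n)) := ⟨by simpa using hμ n⟩
  rw [Kernel.comap_apply, finitePartKernel_apply]

lemma measurableSet_of_measurable_restrict {α : Type*} [MeasurableSpace α]
    [MeasurableSingletonClass α] {A : Set α}
    (hA : Measurable fun μ : Measure α => μ.restrict A) : MeasurableSet A := by
  have h := (Measure.measurable_coe MeasurableSet.univ).comp (hA.comp Measure.measurable_dirac)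
  have h1 := h (measurableSet_singleton 1)
  convert h1 using 1
  ext x
  by_cases hx : x ∈ A
  · simp [hx]
  · simp [hx]

lemma measurable_map_sub_restrict {d : ℕ} (κ : Kernel (Measure (Fin d → ℝ)) (Fin d → ℝ))
    [IsSFiniteKernel κ] {A : Set (Fin d → ℝ)} (hA : MeasurableSet A) :
    Measurable fun x : (Fin d → ℝ) × Measure (Fin d → ℝ) =>
      (Measure.map (fun y => y - x.1) (κ x.2)).restrict A := by
  refine Measure.measurable_of_measurable_coe _ fun s hs => ?_
  have h := Kernel.measurable_kernel_prodMk_left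
    (κ := κ.comap (Prod.snd : (Fin d → ℝ) × Measure (Fin d → ℝ) → _) measurable_snd)
    (t := {x | x.2 - x.1.1 ∈ s ∩ A})
    ((hs.inter hA).preimage (measurable_snd.sub (measurable_fst.comp measurable_fst)))
  convert h using 2 with x
  rw [Measure.restrict_apply hs, Measure.map_apply (by fun_prop) (hs.inter hA)]
  rfl

lemma map_sub_restrict_restrict {d : ℕ} (μ : Measure (Fin d → ℝ)) {A T : Set (Fin d → ℝ)}
    (hA : MeasurableSet A) {z : Fin d → ℝ} (hT : ∀ a ∈ A, z + a ∈ T) :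
    (Measure.map (fun y => y - z) (μ.restrict T)).restrict A
      = (Measure.map (fun y => y - z) μ).restrict A := by
  have hm : Measurable fun y : Fin d → ℝ => y - z := by fun_prop
  rw [Measure.restrict_map hm hA, Measure.restrict_map hm hA,
    Measure.restrict_restrict (hm hA), Set.inter_eq_left.2]
  intro y hy
  simpa using hT _ hy

lemma ae_restrict_eq_restrict_of_ae_eq {d : ℕ} {Ω : Type*} [MeasurableSpace Ω] {P : Measure Ω}
    {ξ : Ω → Measure (Fin d → ℝ)} (hξ : Measurable ξ) {γ : ℝ≥0∞}
    (hintensity : ∀ C : Set (Fin d → ℝ), MeasurableSet C → ∫⁻ ω, ξ ω C ∂P = γ * volume C)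
    {S T : Set (Fin d → ℝ)} (hST : S =ᵐ[volume] T) :
    ∀ᵐ ω ∂P, (ξ ω).restrict S = (ξ ω).restrict T := by
  obtain ⟨N, hN, hNm, hN0⟩ := exists_measurable_superset_of_null (ae_iff.1 hST)
  have h0 : ∫⁻ ω, ξ ω N ∂P = 0 := by rw [hintensity N hNm, hN0, mul_zero]
  have hNξ := (lintegral_eq_zero_iff ((Measure.measurable_coe hNm).comp hξ)).1 h0
  filter_upwards [hNξ] with ω hω
  exact Measure.restrict_congr_set (ae_iff.2 (measure_mono_null hN hω))

lemma ae_measure_lt_top {d : ℕ} {Ω : Type*} [MeasurableSpace Ω] {P : Measure Ω}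
    {ξ : Ω → Measure (Fin d → ℝ)} (hξ : Measurable ξ) {γ : ℝ≥0∞} (hγ : γ ≠ ∞)
    (hintensity : ∀ C : Set (Fin d → ℝ), MeasurableSet C → ∫⁻ ω, ξ ω C ∂P = γ * volume C)
    {C : Set (Fin d → ℝ)} (hC : MeasurableSet C) (hCfin : volume C ≠ ∞) :
    ∀ᵐ ω ∂P, ξ ω C < ∞ := by
  refine ae_lt_top ((Measure.measurable_coe hC).comp hξ) ?_
  rw [hintensity C hC]
  exact ENNReal.mul_ne_top hγ hCfin

lemma exists_kernel_eq_self_ae {d : ℕ} {Ω : Type*} [MeasurableSpace Ω] {P : Measure Ω}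
    {ξ : Ω → Measure (Fin d → ℝ)} (hξ : Measurable ξ) {γ : ℝ≥0∞} (hγ : γ ≠ ∞)
    (hintensity : ∀ C : Set (Fin d → ℝ), MeasurableSet C → ∫⁻ ω, ξ ω C ∂P = γ * volume C) :
    ∃ κ : Kernel (Measure (Fin d → ℝ)) (Fin d → ℝ), IsSFiniteKernel κ ∧
      ∀ᵐ ω ∂P, ∀ C, κ ((ξ ω).restrict C) = (ξ ω).restrict C := by
  let K := disjointed (spanningSets (volume : Measure (Fin d → ℝ)))
  have hK : ∀ n, MeasurableSet (K n) := .disjointed (measurableSet_spanningSets _)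
  refine ⟨piecewiseFiniteKernel hK, inferInstance, ?_⟩
  have hfin : ∀ᵐ ω ∂P, ∀ n, ξ ω (K n) < ∞ := ae_all_iff.2 fun n =>
    ae_measure_lt_top hξ hγ hintensity (hK n)
      (((measure_mono (disjointed_subset _ n)).trans_lt (measure_spanningSets_lt_top _ n)).ne)
  filter_upwards [hfin] with ω hω C
  refine piecewiseFiniteKernel_apply hK (disjoint_disjointed _) ?_
    fun n => (Measure.restrict_apply_le _ _).trans_lt (hω n)
  rw [iUnion_disjointed, iUnion_spanningSets]

end Kernels

/-- Equation (2.1) of the paper (special case `ζ = ξ`, `D = {o}` of Proposition 2.2,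
generalizing a theorem of Hansen–Poghosyan): the total variation distance between the
restriction `ξ_A` of a stationary point process of intensity `γ` and the corresponding
restriction of its Palm version `ξ^o` at the origin is bounded by
`4 (E[ξ(B)^p])^(1/p) / E[ξ(B)] · (β^ξ_{B, B+A})^(1 - 1/p - 1/q)`.

The space `N` of counting measures is modelled by `Measure (Fin d → ℝ)` with the Giry
σ-algebra; `θ_x μ = μ.map (· + x)`; the Palm version `ξ^o` is encoded by its law `ρ`,
a probability measure on `N` satisfying the refined Campbell identity `hPalm`. -/
theorem stmt4 {d : ℕ} {Ω : Type*} [MeasurableSpace Ω] (P : Measure Ω) [IsProbabilityMeasure P]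
    (ξ : Ω → Measure (Fin d → ℝ)) (hξ : Measurable ξ) (hξσ : ∀ ω, SigmaFinite (ξ ω))
    (hstat : ∀ x : Fin d → ℝ,
        P.map (fun ω => Measure.map (fun y => y + x) (ξ ω)) = P.map ξ)
    (γ : ℝ≥0∞) (hγ0 : 0 < γ) (hγfin : γ ≠ ∞)
    (hintensity : ∀ C : Set (Fin d → ℝ), MeasurableSet C →
        ∫⁻ ω, ξ ω C ∂P = γ * volume C)
    (ρ : Measure (Measure (Fin d → ℝ))) [IsProbabilityMeasure ρ]
    (hPalm : ∀ f : (Fin d → ℝ) × Measure (Fin d → ℝ) → ℝ≥0∞, Measurable f →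
        ∫⁻ ω, ∫⁻ z, f (z, Measure.map (fun y => y - z) (ξ ω)) ∂(ξ ω) ∂P
          = γ * ∫⁻ z, (∫⁻ μ, f (z, μ) ∂ρ) ∂volume)
    (A : Set (Fin d → ℝ))
    (hA : Measurable (fun zμ : (Fin d → ℝ) × Measure (Fin d → ℝ) =>
        zμ.2.restrict ((fun a => a + zμ.1) '' A)))
    (B : Set (Fin d → ℝ)) (hB : IsCompact B) (hBpos : 0 < volume B)
    (p q : ℝ) (hp : 0 < p) (hq : 0 < q) (hpq : 1 / p + 1 / q ≤ 1) :
    (let jointLaw : Measure (Measure (Fin d → ℝ) × Measure (Fin d → ℝ)) :=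
      P.map (fun ω => ((ξ ω).restrict B, (ξ ω).restrict (B + A)));
    let prodLaw : Measure (Measure (Fin d → ℝ) × Measure (Fin d → ℝ)) :=
      (P.map (fun ω => (ξ ω).restrict B)).prod (P.map (fun ω => (ξ ω).restrict (B + A)));
    let βmix : ℝ≥0∞ :=
      ⨆ (C : Set (Measure (Fin d → ℝ) × Measure (Fin d → ℝ))) (_ : MeasurableSet C),
        (jointLaw C - prodLaw C) ⊔ (prodLaw C - jointLaw C);
    (⨆ (𝒜 : Set (Measure (Fin d → ℝ))) (_ : MeasurableSet 𝒜),
        (P {ω | (ξ ω).restrict A ∈ 𝒜} - ρ {μ | μ.restrict A ∈ 𝒜}) ⊔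
          (ρ {μ | μ.restrict A ∈ 𝒜} - P {ω | (ξ ω).restrict A ∈ 𝒜})) ≤
      4 * (∫⁻ ω, (ξ ω B) ^ p ∂P) ^ (1 / p) / (∫⁻ ω, ξ ω B ∂P) *
        βmix ^ (1 - 1 / p - 1 / q)) := by
  intro jointLaw prodLaw βmix
  have hAm : MeasurableSet A := measurableSet_of_measurable_restrict (by
    simpa [Function.comp_def] using hA.comp (measurable_prodMk_left (x := (0 : Fin d → ℝ))))
  have hBm := hB.measurableSet
  have hBfin : volume B ≠ ∞ := hB.measure_lt_top.ne
  have hSnull : NullMeasurableSet (B + A) (volume : Measure (Fin d → ℝ)) := by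
    have h : AnalyticSet (B + A) := by
      rw [← Set.image2_add, ← Set.image_prod]
      exact (hBm.prod hAm).analyticSet_image (measurable_fst.add measurable_snd)
    exact h.nullMeasurableSet
  obtain ⟨T, hST, hTm, hTS⟩ := hSnull.exists_measurable_superset_ae_eq
  have hξT := ae_restrict_eq_restrict_of_ae_eq hξ hintensity hTS.symm
  obtain ⟨κ, hκ, hκξ⟩ := exists_kernel_eq_self_ae hξ hγfin hintensity
  have hmB : Measurable fun ω => (ξ ω).restrict B := (measurable_measure_restrict hBm).comp hξ
  have hmT : Measurable fun ω => (ξ ω).restrict T := (measurable_measure_restrict hTm).comp hξ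
  have hmBT := hmB.prodMk hmT
  have hJ : jointLaw = P.map (fun ω => ((ξ ω).restrict B, (ξ ω).restrict T)) :=
    Measure.map_congr (by filter_upwards [hξT] with ω hω; rw [hω])
  have hQ : prodLaw = (P.map fun ω => (ξ ω).restrict B).prod (P.map fun ω => (ξ ω).restrict T) := by
    simp only [prodLaw, Measure.map_congr hξT]
  have : IsProbabilityMeasure (P.map fun ω => (ξ ω).restrict B) :=
    Measure.isProbabilityMeasure_map hmB.aemeasurable
  have : IsProbabilityMeasure (P.map fun ω => (ξ ω).restrict T) :=
    Measure.isProbabilityMeasure_map hmT.aemeasurable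
  have : IsProbabilityMeasure jointLaw := by
    rw [hJ]; exact Measure.isProbabilityMeasure_map hmBT.aemeasurable
  have : IsProbabilityMeasure prodLaw := by rw [hQ]; infer_instance
  have hβ1 : βmix ≤ 1 := iSup₂_le fun C _ =>
    sup_le (tsub_le_self.trans prob_le_one) (tsub_le_self.trans prob_le_one)
  have hβ (C) (hC : MeasurableSet C) :
      (jointLaw C - prodLaw C) ⊔ (prodLaw C - jointLaw C) ≤ βmix :=
    le_iSup₂ (f := fun C (_ : MeasurableSet C) =>
      (jointLaw C - prodLaw C) ⊔ (prodLaw C - jointLaw C)) C hC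
  have hq' : 0 < 1 / q := one_div_pos.2 hq
  have hp1 : 1 < p := by
    have h : 1 / p < 1 := by linarith
    rwa [div_lt_one hp] at h
  let M := (∫⁻ ω, (ξ ω B) ^ p ∂P) ^ (1 / p)
  -- Both laws have the law of `ξ_B` as first marginal.
  have hh : Measurable fun x : Measure (Fin d → ℝ) × Measure (Fin d → ℝ) => κ x.1 Set.univ :=
    (κ.measurable_coe .univ).comp measurable_fst
  have hMB : ∫⁻ μ, (κ μ Set.univ) ^ p ∂(P.map fun ω => (ξ ω).restrict B)
      = ∫⁻ ω, (ξ ω B) ^ p ∂P := by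
    rw [lintegral_map ((κ.measurable_coe .univ).pow_const p) hmB]
    refine lintegral_congr_ae ?_
    filter_upwards [hκξ] with ω hω
    simp [hω B]
  have hMJ : ∫⁻ x, (κ x.1 Set.univ) ^ p ∂jointLaw = ∫⁻ ω, (ξ ω B) ^ p ∂P := by
    rw [← hMB, hJ, lintegral_map (hh.pow_const p) hmBT,
      lintegral_map ((κ.measurable_coe .univ).pow_const p) hmB]
  have hMQ : ∫⁻ x, (κ x.1 Set.univ) ^ p ∂prodLaw = ∫⁻ ω, (ξ ω B) ^ p ∂P := by
    rw [← hMB, hQ, lintegral_prod _ (hh.pow_const p).aemeasurable]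
    simp
  rw [hintensity B hBm]
  have ha0 : γ * volume B ≠ 0 := mul_ne_zero hγ0.ne' hBpos.ne'
  have hafin : γ * volume B ≠ ∞ := ENNReal.mul_ne_top hγfin hBfin
  have hpow : βmix ^ (1 - 1 / p) ≤ βmix ^ (1 - 1 / p - 1 / q) :=
    ENNReal.rpow_le_rpow_of_exponent_ge hβ1 (by linarith)
  refine iSup₂_le fun 𝒜 h𝒜 => ?_
  let G : (Fin d → ℝ) × Measure (Fin d → ℝ) → ℝ≥0∞ := fun x =>
    𝒜.indicator 1 ((Measure.map (fun y => y - x.1) (κ x.2)).restrict A)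
  have hG : Measurable G := (measurable_one.indicator h𝒜).comp (measurable_map_sub_restrict κ hAm)
  let H : Measure (Fin d → ℝ) × Measure (Fin d → ℝ) → ℝ≥0∞ := fun x => ∫⁻ z, G (z, x.2) ∂(κ x.1)
  have hH : Measurable H := by
    have h : Measurable fun y : (Measure (Fin d → ℝ) × Measure (Fin d → ℝ)) × (Fin d → ℝ) =>
        G (y.2, y.1.2) := hG.comp (measurable_snd.prodMk (measurable_snd.comp measurable_fst))
    exact h.lintegral_kernel_prod_right' (κ := κ.comap Prod.fst measurable_fst)
  have hHh (x) : H x ≤ κ x.1 Set.univ := by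
    refine (lintegral_mono fun z => ?_).trans_eq lintegral_one
    exact Set.indicator_le_self' (fun _ _ => zero_le) _
  have hGξ : ∀ᵐ ω ∂P, ∀ z ∈ B, G (z, (ξ ω).restrict T)
      = 𝒜.indicator 1 ((Measure.map (fun y => y - z) (ξ ω)).restrict A) := by
    filter_upwards [hκξ] with ω hω z hz
    simp only [G, hω T]
    rw [map_sub_restrict_restrict (ξ ω) hAm fun a ha => hST (Set.add_mem_add hz ha)]
  have hrA := measurable_measure_restrict hAm
  have hHJ : ∫⁻ x, H x ∂jointLaw = γ * volume B * ρ {μ | μ.restrict A ∈ 𝒜} := by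
    have hf : MeasurableSet (B ×ˢ ((fun μ : Measure (Fin d → ℝ) => μ.restrict A) ⁻¹' 𝒜)) :=
      hBm.prod (hrA h𝒜)
    have hP := hPalm _ (measurable_one.indicator hf)
    have hR : ∫⁻ z, (∫⁻ μ, (B ×ˢ ((fun μ : Measure (Fin d → ℝ) => μ.restrict A) ⁻¹' 𝒜)).indicator
        1 (z, μ) ∂ρ) = volume B * ρ {μ | μ.restrict A ∈ 𝒜} := by
      rw [← lintegral_prod _ (measurable_one.indicator hf).aemeasurable, lintegral_indicator_one hf,
        Measure.prod_prod]
      rfl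
    rw [hR, ← mul_assoc] at hP
    rw [← hP, hJ, lintegral_map hH hmBT]
    refine lintegral_congr_ae ?_
    filter_upwards [hκξ, hGξ] with ω hω hGω
    simp only [H, hω B]
    rw [← lintegral_indicator hBm]
    refine lintegral_congr fun z => ?_
    by_cases hz : z ∈ B
    · rw [Set.indicator_of_mem hz, hGω z hz]
      by_cases h : (Measure.map (fun y => y - z) (ξ ω)).restrict A ∈ 𝒜
      · rw [Set.indicator_of_mem h]
        exact (Set.indicator_of_mem (s := B ×ˢ _) ⟨hz, h⟩ 1).symm
      · rw [Set.indicator_of_notMem h, Set.indicator_of_notMem fun h' => h h'.2]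
    · simp [Set.indicator, hz]
  have hHQ : ∫⁻ x, H x ∂prodLaw = γ * volume B * P {ω | (ξ ω).restrict A ∈ 𝒜} := by
    have hstat' (z) (hz : z ∈ B) : ∫⁻ ν, G (z, ν) ∂(P.map fun ω => (ξ ω).restrict T)
        = P {ω | (ξ ω).restrict A ∈ 𝒜} := by
      have hsub : (fun y : Fin d → ℝ => y - z) = fun y => y + -z := by
        ext1 y; exact sub_eq_add_neg y z
      have hmz : Measurable fun ω => Measure.map (fun y => y - z) (ξ ω) :=
        (Measure.measurable_map _ (by fun_prop)).comp hξ
      calc ∫⁻ ν, G (z, ν) ∂(P.map fun ω => (ξ ω).restrict T)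
          = ∫⁻ ω, G (z, (ξ ω).restrict T) ∂P :=
            lintegral_map (hG.comp measurable_prodMk_left) hmT
        _ = ∫⁻ ω, 𝒜.indicator 1 ((Measure.map (fun y => y - z) (ξ ω)).restrict A) ∂P := by
            refine lintegral_congr_ae ?_
            filter_upwards [hGξ] with ω hω using hω z hz
        _ = ∫⁻ μ, 𝒜.indicator 1 (μ.restrict A)
              ∂(P.map fun ω => Measure.map (fun y => y - z) (ξ ω)) :=
            (lintegral_map ((measurable_one.indicator h𝒜).comp hrA) hmz).symm
        _ = ∫⁻ ω, 𝒜.indicator 1 ((ξ ω).restrict A) ∂P := by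
            rw [hsub, hstat]
            exact lintegral_map ((measurable_one.indicator h𝒜).comp hrA) hξ
        _ = P {ω | (ξ ω).restrict A ∈ 𝒜} :=
            lintegral_indicator_one (hrA.comp hξ h𝒜)
    have hξB : Measurable fun ω => ξ ω B := (Measure.measurable_coe hBm).comp hξ
    rw [hQ, lintegral_prod _ hH.aemeasurable, lintegral_map hH.lintegral_prod_right' hmB,
      ← hintensity B hBm, ← lintegral_mul_const _ hξB]
    refine lintegral_congr_ae ?_
    filter_upwards [hκξ] with ω hω
    have hswap : Measurable (Function.uncurry fun (ν : Measure (Fin d → ℝ)) (z : Fin d → ℝ) =>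
        G (z, ν)) := hG.comp measurable_swap
    have hsf : SFinite ((ξ ω).restrict B) := hω B ▸ inferInstance
    simp only [H, hω B]
    rw [lintegral_lintegral_swap hswap.aemeasurable, setLIntegral_congr_fun hBm hstat',
      setLIntegral_const, mul_comm]
  have finish {u v : ℝ≥0∞} (h : γ * volume B * u ≤ γ * volume B * v + M * βmix ^ (1 - 1 / p)) :
      u - v ≤ 4 * M / (γ * volume B) * βmix ^ (1 - 1 / p - 1 / q) := by
    rw [tsub_le_iff_left]
    calc u = (γ * volume B)⁻¹ * (γ * volume B * u) := by
          rw [← mul_assoc, ENNReal.inv_mul_cancel ha0 hafin, one_mul]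
      _ ≤ (γ * volume B)⁻¹ * (γ * volume B * v + M * βmix ^ (1 - 1 / p)) := by gcongr
      _ = v + 1 * M / (γ * volume B) * βmix ^ (1 - 1 / p) := by
          rw [mul_add, ← mul_assoc, ENNReal.inv_mul_cancel ha0 hafin, one_mul, one_mul,
            ENNReal.div_eq_inv_mul, ← mul_assoc]
      _ ≤ v + 4 * M / (γ * volume B) * βmix ^ (1 - 1 / p - 1 / q) := by
          gcongr
          norm_num
  refine sup_le (finish ?_) (finish ?_)
  · rw [← hHJ, ← hHQ]
    simpa only [M, hMQ] using lintegral_le_lintegral_add_of_tv_le (J := prodLaw) (Q := jointLaw)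
      (fun C hC => le_sup_right.trans (hβ C hC)) hh hHh hp1
  · rw [← hHJ, ← hHQ]
    simpa only [M, hMJ] using lintegral_le_lintegral_add_of_tv_le (J := jointLaw) (Q := prodLaw)
      (fun C hC => le_sup_left.trans (hβ C hC)) hh hHh hp1
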